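/- There exists an absolute constant c > 0 such that for every integer n ≥ 1 and every z = (z₁,z₂) ∈ ℝ² with 2⁻⁷n⁻² ≤ z₁ ≤ 1/2 and 2⁻⁷n⁻² ≤ z₂ ≤ 1/2: λₙ(z, S) ≤ c·n⁻²·√(z₁·z₂), where S := [0,1]² is the unit square. -/

import Mathlib

open MeasureTheory Set Pointwise

noncomputable section

abbrev E (d : ℕ) := EuclideanSpace ℝ (Fin d)
abbrev E2 := EuclideanSpace ℝ (Fin 2)

/-- The Christoffel function `λ_n(x, D)` for Lebesgue measure on `D ⊆ ℝ^d`. -/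
noncomputable def christoffel (d n : ℕ) (x : E d) (D : Set (E d)) : ℝ :=
  sInf { r : ℝ | ∃ p : MvPolynomial (Fin d) ℝ, p.totalDegree ≤ n ∧
    MvPolynomial.eval (fun i => x i) p = 1 ∧
    r = ∫ y in D, (MvPolynomial.eval (fun i => y i) p) ^ 2 }

/-- Determinant of the linear part of an affine automorphism of `ℝ^d`. -/
noncomputable def adet {d : ℕ} (T : E d ≃ᵃ[ℝ] E d) : ℝ :=
  LinearMap.det (T.linear : E d →ₗ[ℝ] E d)

/-- The closed unit ball `B` of `ℝ²`. -/
def ballE : Set E2 := Metric.closedBall 0 1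

/-- The unit square `S = [0,1]²` in `ℝ²`. -/
def squareS : Set E2 := {y : E2 | y 0 ∈ Icc (0:ℝ) 1 ∧ y 1 ∈ Icc (0:ℝ) 1}

/-- The geometric quantity `L(x, D)`. -/
noncomputable def Lfun (x : E2) (D : Set E2) : ℝ :=
  sSup { r : ℝ | ∃ T : E2 ≃ᵃ[ℝ] E2, x ∈ T '' ballE ∧ T '' ballE ⊆ D ∧
    r = Real.sqrt (1 - ‖T.symm x‖) * |adet T| }

/-- The geometric quantity `U(x, D)`. -/
noncomputable def Ufun (x : E2) (D : Set E2) : ℝ :=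
  sInf { r : ℝ | ∃ T : E2 ≃ᵃ[ℝ] E2, x ∈ T '' ((2:ℝ)⁻¹ • squareS) ∧ D ⊆ T '' squareS ∧
    r = Real.sqrt ((T.symm x) 0 * (T.symm x) 1) * |adet T| }

/-- A convex body in `ℝ²`: a compact convex set with nonempty interior. -/
def IsConvexBody (D : Set E2) : Prop := Convex ℝ D ∧ IsCompact D ∧ (interior D).Nonempty

/-- The point `(a, b)` of `ℝ²`. -/
noncomputable def e2 (a b : ℝ) : E2 := (WithLp.equiv 2 (Fin 2 → ℝ)).symm ![a, b]

/-- The (unnormalised) Fejér kernel `∑_{|k| < M} (M - |k|) cos (kα)`. -/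
def fejer (M : ℕ) (α : ℝ) : ℝ :=
  ∑ k ∈ Finset.range M, 2 * ((M:ℝ) - k) * Real.cos (k * α) - M

theorem dirichlet_mul_one_sub_cos (M : ℕ) (α : ℝ) :
    (2 * ∑ k ∈ Finset.range (M + 1), Real.cos (k * α) - 1) * (1 - Real.cos α) =
      Real.cos (M * α) - Real.cos ((M + 1 : ℕ) * α) := by
  induction M with
  | zero => simp; ring
  | succ M ih =>
    rw [Finset.sum_range_succ]
    have h := Real.cos_add_cos (((M + 1 + 1 : ℕ) : ℝ) * α) (M * α)
    have h₁ : (((M + 1 + 1 : ℕ) : ℝ) * α + M * α) / 2 = ((M + 1 : ℕ) : ℝ) * α := by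
      push_cast; ring
    have h₂ : (((M + 1 + 1 : ℕ) : ℝ) * α - M * α) / 2 = α := by push_cast; ring
    rw [h₁, h₂] at h
    linear_combination ih + h

theorem fejer_succ (M : ℕ) (α : ℝ) :
    fejer (M + 1) α =
      fejer M α + (2 * ∑ k ∈ Finset.range (M + 1), Real.cos (k * α) - 1) := by
  unfold fejer
  rw [Finset.sum_range_succ, Finset.sum_range_succ, mul_add, Finset.mul_sum]
  have h : ∑ k ∈ Finset.range M, 2 * (((M + 1 : ℕ) : ℝ) - k) * Real.cos (k * α) =
      ∑ k ∈ Finset.range M, 2 * ((M:ℝ) - k) * Real.cos (k * α) +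
        ∑ k ∈ Finset.range M, 2 * Real.cos (k * α) := by
    rw [← Finset.sum_add_distrib]
    refine Finset.sum_congr rfl fun k _ => ?_
    push_cast; ring
  rw [h]
  push_cast; ring

theorem fejer_mul_one_sub_cos (M : ℕ) (α : ℝ) :
    fejer M α * (1 - Real.cos α) = 1 - Real.cos (M * α) := by
  induction M with
  | zero => simp [fejer]
  | succ M ih =>
    rw [fejer_succ]
    linear_combination ih + dirichlet_mul_one_sub_cos M α

theorem fejer_mul_one_sub_cos_le (M : ℕ) (α : ℝ) : fejer M α * (1 - Real.cos α) ≤ 2 := by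
  rw [fejer_mul_one_sub_cos]
  linarith [Real.neg_one_le_cos (M * α)]

theorem fejer_zero_right (M : ℕ) : fejer M 0 = (M:ℝ) ^ 2 := by
  induction M with
  | zero => simp [fejer]
  | succ M ih =>
    rw [fejer_succ, ih]
    simp
    ring

theorem fejer_le (M : ℕ) (α : ℝ) : fejer M α ≤ (M:ℝ) ^ 2 := by
  rw [← fejer_zero_right]
  unfold fejer
  gcongr with k hk
  · have : (k:ℝ) ≤ M := by exact_mod_cast (Finset.mem_range.1 hk).le
    linarith
  · rw [mul_zero, Real.cos_zero]
    exact Real.cos_le_one _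

theorem fejer_nonneg (M : ℕ) (α : ℝ) : 0 ≤ fejer M α := by
  rcases (Real.cos_le_one α).lt_or_eq with h | h
  · refine nonneg_of_mul_nonneg_left ?_ (sub_pos.2 h)
    rw [fejer_mul_one_sub_cos]
    linarith [Real.cos_le_one (M * α)]
  · obtain ⟨j, rfl⟩ := (Real.cos_eq_one_iff α).1 h
    have : fejer M (j * (2 * Real.pi)) = fejer M 0 := by
      unfold fejer
      congr 1
      refine Finset.sum_congr rfl fun k _ => ?_
      have : (k:ℝ) * (j * (2 * Real.pi)) = ((k * j : ℤ) : ℝ) * (2 * Real.pi) := by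
        push_cast; ring
      rw [this, Real.cos_int_mul_two_pi, mul_zero, Real.cos_zero]
    rw [this, fejer_zero_right]
    positivity

/-- `fejer M (φ - ψ) + fejer M (φ + ψ)` as a polynomial in `cos φ`. -/
theorem fejer_sub_add_fejer_add (M : ℕ) (φ ψ : ℝ) :
    fejer M (φ - ψ) + fejer M (φ + ψ) =
      ∑ k ∈ Finset.range M, 4 * ((M:ℝ) - k) * Real.cos (k * ψ) * Real.cos (k * φ)
        - 2 * M := by
  have h : ∀ k : ℕ, 4 * ((M:ℝ) - k) * Real.cos (k * ψ) * Real.cos (k * φ) =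
      2 * ((M:ℝ) - k) * Real.cos (k * (φ - ψ)) + 2 * ((M:ℝ) - k) * Real.cos (k * (φ + ψ)) := by
    intro k
    rw [mul_sub (k:ℝ), mul_add (k:ℝ), Real.cos_sub, Real.cos_add]
    ring
  simp only [h, Finset.sum_add_distrib, fejer]
  ring

theorem sin_sq_le (φ ψ : ℝ) :
    Real.sin φ ^ 2 ≤ 2 * Real.sin ψ ^ 2 + 4 * (1 - Real.cos (φ - ψ)) := by
  have h : Real.sin φ = Real.sin ψ * Real.cos (φ - ψ) + Real.cos ψ * Real.sin (φ - ψ) := by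
    rw [← Real.sin_add]
    congr 1
    ring
  set α := φ - ψ
  have h₁ : Real.sin φ ^ 2 ≤ 2 * (Real.sin ψ * Real.cos α) ^ 2
      + 2 * (Real.cos ψ * Real.sin α) ^ 2 := by
    rw [h]
    linarith [sq_nonneg (Real.sin ψ * Real.cos α - Real.cos ψ * Real.sin α)]
  have h₂ : (Real.sin ψ * Real.cos α) ^ 2 ≤ Real.sin ψ ^ 2 := by
    rw [mul_pow]
    exact mul_le_of_le_one_right (sq_nonneg _) (Real.cos_sq_le_one α)
  have h₃ : (Real.cos ψ * Real.sin α) ^ 2 ≤ Real.sin α ^ 2 := by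
    rw [mul_pow]
    exact mul_le_of_le_one_left (sq_nonneg _) (Real.cos_sq_le_one ψ)
  have h₄ : Real.sin α ^ 2 ≤ 2 * (1 - Real.cos α) := by
    rw [Real.sin_sq]
    linarith [sq_nonneg (1 - Real.cos α)]
  linarith

theorem fejer_mul_sin_le {M : ℕ} {s α φ : ℝ} (hs : 0 < s) (hMs : 1 ≤ 256 * ((M:ℝ) ^ 2 * s ^ 2))
    (h : Real.sin φ ^ 2 ≤ 2 * s ^ 2 + 4 * (1 - Real.cos α)) :
    fejer M α * Real.sin φ ≤ 1026 * (s * (M:ℝ) ^ 2) := by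
  have hF := fejer_nonneg M α
  have h₁ : fejer M α * (2 * (s * Real.sin φ)) ≤
      fejer M α * (3 * s ^ 2 + 4 * (1 - Real.cos α)) := by
    gcongr
    linarith [sq_nonneg (s - Real.sin φ)]
  have h₂ := fejer_mul_one_sub_cos_le M α
  have h₃ : fejer M α * s ^ 2 ≤ (M:ℝ) ^ 2 * s ^ 2 := by
    gcongr
    exact fejer_le M α
  refine le_of_mul_le_mul_left ?_ hs
  linarith

theorem integral_cos_nat_mul (k : ℕ) :
    ∫ φ in (0:ℝ)..Real.pi, Real.cos (k * φ) = if k = 0 then Real.pi else 0 := by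
  split_ifs with hk
  · simp [hk]
  · have hk' : (k:ℝ) ≠ 0 := by exact_mod_cast hk
    rw [intervalIntegral.integral_comp_mul_left (fun x => Real.cos x) hk', integral_cos]
    simp [Real.sin_nat_mul_pi]

@[fun_prop]
theorem continuous_fejer (M : ℕ) : Continuous (fejer M) := by
  unfold fejer
  fun_prop

theorem integral_fejer_sub_add_fejer_add {M : ℕ} (hM : 1 ≤ M) (ψ : ℝ) :
    ∫ φ in (0:ℝ)..Real.pi, (fejer M (φ - ψ) + fejer M (φ + ψ)) = 2 * Real.pi * M := by
  simp only [fejer_sub_add_fejer_add]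
  rw [intervalIntegral.integral_sub
      (by apply Continuous.intervalIntegrable; fun_prop) (by simp),
    intervalIntegral.integral_finsetSum
      (fun k _ => by apply Continuous.intervalIntegrable; fun_prop)]
  simp only [intervalIntegral.integral_const_mul, integral_cos_nat_mul]
  rw [Finset.sum_eq_single_of_mem 0 (Finset.mem_range.2 hM) (by intro b _ hb; simp [hb])]
  simp
  ring

theorem integral_sq_mul_sin_le {M : ℕ} (hM : 1 ≤ M) {ψ : ℝ} (hs : 0 < Real.sin ψ)
    (hMs : 1 ≤ 256 * ((M:ℝ) ^ 2 * Real.sin ψ ^ 2)) :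
    ∫ φ in (0:ℝ)..Real.pi, (fejer M (φ - ψ) + fejer M (φ + ψ)) ^ 2 * Real.sin φ ≤
      4104 * Real.pi * (Real.sin ψ * (M:ℝ) ^ 3) := by
  have hle : ∀ φ, (fejer M (φ - ψ) + fejer M (φ + ψ)) ^ 2 * Real.sin φ ≤
      2052 * (Real.sin ψ * (M:ℝ) ^ 2) * (fejer M (φ - ψ) + fejer M (φ + ψ)) := by
    intro φ
    have h₁ := fejer_mul_sin_le hs hMs (sin_sq_le φ ψ)
    have h₂ := fejer_mul_sin_le (α := φ + ψ) (φ := φ) hs hMs (by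
      simpa using sin_sq_le φ (-ψ))
    have h₃ := add_nonneg (fejer_nonneg M (φ - ψ)) (fejer_nonneg M (φ + ψ))
    calc _ = (fejer M (φ - ψ) * Real.sin φ + fejer M (φ + ψ) * Real.sin φ) *
          (fejer M (φ - ψ) + fejer M (φ + ψ)) := by ring
      _ ≤ _ := by
        gcongr
        linarith
  calc _ ≤ ∫ φ in (0:ℝ)..Real.pi,
        2052 * (Real.sin ψ * (M:ℝ) ^ 2) * (fejer M (φ - ψ) + fejer M (φ + ψ)) :=
        intervalIntegral.integral_mono Real.pi_pos.le
          (by apply Continuous.intervalIntegrable; fun_prop)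
          (by apply Continuous.intervalIntegrable; fun_prop) hle
    _ = _ := by
        rw [intervalIntegral.integral_const_mul, integral_fejer_sub_add_fejer_add hM]
        ring

theorem integral_comp_cos (P : Polynomial ℝ) :
    ∫ y in (0:ℝ)..1, P.eval (1 - 2 * y) =
      2⁻¹ * ∫ φ in (0:ℝ)..Real.pi, P.eval (Real.cos φ) * Real.sin φ := by
  have h := intervalIntegral.integral_comp_mul_deriv (a := 0) (b := Real.pi)
    (f := fun φ => (1 - Real.cos φ) / 2) (f' := fun φ => Real.sin φ / 2)
    (g := fun y => P.eval (1 - 2 * y))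
    (fun x _ => by
      simpa using ((Real.hasDerivAt_cos x).const_sub 1).div_const 2)
    (by fun_prop) (by fun_prop)
  simp only [Function.comp_def, Real.cos_zero, Real.cos_pi] at h
  norm_num at h
  rw [← h, ← intervalIntegral.integral_const_mul]
  congr 1
  ext φ
  rw [show 1 - 2 * ((1 - Real.cos φ) / 2) = Real.cos φ by ring]
  ring

theorem exists_polynomial_cos_eq_fejer (M : ℕ) (ψ : ℝ) :
    ∃ P : Polynomial ℝ, P.natDegree ≤ M - 1 ∧
      ∀ φ, P.eval (Real.cos φ) = fejer M (φ - ψ) + fejer M (φ + ψ) := by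
  refine ⟨∑ k ∈ Finset.range M, Polynomial.C (4 * ((M:ℝ) - k) * Real.cos (k * ψ)) *
    Polynomial.Chebyshev.T ℝ k - Polynomial.C (2 * (M:ℝ)), ?_, fun φ => ?_⟩
  · refine (Polynomial.natDegree_sub_C (R := ℝ)).trans_le
      (Polynomial.natDegree_sum_le_of_forall_le _ _ fun k hk => ?_)
    refine (Polynomial.natDegree_C_mul_le _ _).trans ?_
    have := Finset.mem_range.1 hk
    rw [Polynomial.natDegree_le_iff_degree_le, Polynomial.Chebyshev.degree_T]
    simp only [Int.natAbs_natCast, Nat.cast_le]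
    omega
  · rw [fejer_sub_add_fejer_add]
    simp [Polynomial.eval_finsetSum, Polynomial.Chebyshev.T_real_cos]

/-- A univariate polynomial peaking at `t`, with small `L²` norm on `[0,1]`. -/
theorem exists_polynomial_integral_sq_le {M : ℕ} (hM : 1 ≤ M) {t : ℝ}
    (ht : 1 ≤ 512 * ((M:ℝ) ^ 2 * t)) (ht' : t ≤ 1 / 2) :
    ∃ P : Polynomial ℝ, P.natDegree ≤ M - 1 ∧ P.eval t = 1 ∧
      ∫ y in (0:ℝ)..1, P.eval y ^ 2 ≤ 4104 * Real.pi * Real.sqrt t / M := by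
  have hM0 : (0:ℝ) < M := by exact_mod_cast hM
  have ht0 : 0 < t := by
    by_contra! h
    have := mul_nonpos_of_nonneg_of_nonpos (sq_nonneg (M:ℝ)) h
    linarith
  set ψ := Real.arccos (1 - 2 * t)
  have hcos : Real.cos ψ = 1 - 2 * t := Real.cos_arccos (by linarith) (by linarith)
  have hsin : Real.sin ψ ^ 2 = 4 * (t * (1 - t)) := by
    rw [Real.sin_sq, hcos]; ring
  have hsin0 : 0 < Real.sin ψ :=
    (Real.sin_nonneg_of_nonneg_of_le_pi (Real.arccos_nonneg _) (Real.arccos_le_pi _)).lt_of_ne'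
      (fun h => by rw [h] at hsin; nlinarith)
  have hsin_le : Real.sin ψ ≤ 2 * Real.sqrt t := by
    refine abs_le_of_sq_le_sq' ?_ (by positivity) |>.2
    rw [hsin, mul_pow, Real.sq_sqrt ht0.le]
    nlinarith
  have hMs : 1 ≤ 256 * ((M:ℝ) ^ 2 * Real.sin ψ ^ 2) := by
    have : 2 * t ≤ Real.sin ψ ^ 2 := by rw [hsin]; nlinarith
    have := mul_le_mul_of_nonneg_left this (sq_nonneg (M:ℝ))
    linarith
  obtain ⟨Q, hQdeg, hQ⟩ := exists_polynomial_cos_eq_fejer M ψ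
  set K := Q.eval (Real.cos ψ) with hK
  have hKM : (M:ℝ) ^ 2 ≤ K := by
    rw [hK, hQ, sub_self, fejer_zero_right]
    linarith [fejer_nonneg M (ψ + ψ)]
  have hK0 : 0 < K := lt_of_lt_of_le (by positivity) hKM
  refine ⟨Polynomial.C K⁻¹ * Q.comp (1 - 2 * Polynomial.X), ?_, ?_, ?_⟩
  · refine (Polynomial.natDegree_C_mul_le _ _).trans (Polynomial.natDegree_comp_le.trans ?_)
    have : (1 - 2 * Polynomial.X : Polynomial ℝ).natDegree ≤ 1 := by compute_degree
    exact (Nat.mul_le_mul hQdeg this).trans (by simp)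
  · have : Q.eval (1 - 2 * t) = K := by rw [hK, hcos]
    simp [Polynomial.eval_comp, this, hK0.ne']
  · have h := integral_comp_cos (Q ^ 2)
    simp only [Polynomial.eval_pow, hQ] at h
    have hI := integral_sq_mul_sin_le hM hsin0 hMs
    have heq : ∫ y in (0:ℝ)..1,
        (Polynomial.C K⁻¹ * Q.comp (1 - 2 * Polynomial.X)).eval y ^ 2 =
        (∫ y in (0:ℝ)..1, Q.eval (1 - 2 * y) ^ 2) / K ^ 2 := by
      simp [Polynomial.eval_comp, mul_pow, div_eq_inv_mul]
    rw [heq, h]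
    calc _ ≤ (2⁻¹ * (4104 * Real.pi * ((2 * Real.sqrt t) * (M:ℝ) ^ 3))) / ((M:ℝ) ^ 2) ^ 2 := by
          have hI' := hI.trans (b := 4104 * Real.pi * (Real.sin ψ * (M:ℝ) ^ 3))
            (c := 4104 * Real.pi * ((2 * Real.sqrt t) * (M:ℝ) ^ 3)) (by gcongr)
          gcongr
      _ = _ := by field_simp

theorem totalDegree_aeval_X_le {d : ℕ} (i : Fin d) (P : Polynomial ℝ) :
    (Polynomial.aeval (MvPolynomial.X i : MvPolynomial (Fin d) ℝ) P).totalDegree ≤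
      P.natDegree := by
  rw [Polynomial.aeval_eq_sum_range]
  refine MvPolynomial.totalDegree_finsetSum_le fun k hk => ?_
  refine (MvPolynomial.totalDegree_smul_le _ _).trans ?_
  rw [MvPolynomial.totalDegree_X_pow]
  exact Nat.lt_succ_iff.1 (Finset.mem_range.1 hk)

theorem eval_aeval_X {d : ℕ} (i : Fin d) (P : Polynomial ℝ) (v : Fin d → ℝ) :
    MvPolynomial.eval v (Polynomial.aeval (MvPolynomial.X i : MvPolynomial (Fin d) ℝ) P) =
      P.eval (v i) := by
  rw [Polynomial.aeval_def, Polynomial.hom_eval₂]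
  simp [Polynomial.eval₂_eq_eval_map, Polynomial.map_id, MvPolynomial.algebraMap_eq,
    show (MvPolynomial.eval v).comp MvPolynomial.C = RingHom.id ℝ by ext; simp]

theorem setIntegral_squareS_mul (f g : ℝ → ℝ) :
    ∫ y in squareS, f (y 0) * g (y 1) =
      (∫ x in (0:ℝ)..1, f x) * ∫ x in (0:ℝ)..1, g x := by
  have hmp : MeasurePreserving (fun y : E2 => ((y 0, y 1) : ℝ × ℝ)) :=
    (volume_preserving_finTwoArrow ℝ).comp (PiLp.volume_preserving_ofLp (Fin 2))
  have hemb : MeasurableEmbedding (fun y : E2 => ((y 0, y 1) : ℝ × ℝ)) :=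
    (MeasurableEquiv.finTwoArrow (α := ℝ)).measurableEmbedding.comp
      (MeasurableEquiv.toLp 2 (Fin 2 → ℝ)).symm.measurableEmbedding
  have h := hmp.setIntegral_preimage_emb hemb (fun z => f z.1 * g z.2) (Icc 0 1 ×ˢ Icc 0 1)
  have hset : (fun y : E2 => ((y 0, y 1) : ℝ × ℝ)) ⁻¹' (Icc 0 1 ×ˢ Icc 0 1) = squareS := by
    ext y; simp [squareS]; tauto
  rw [hset] at h
  rw [h, Measure.volume_eq_prod, setIntegral_prod_mul,
    intervalIntegral.integral_of_le zero_le_one, intervalIntegral.integral_of_le zero_le_one,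
    integral_Icc_eq_integral_Ioc, integral_Icc_eq_integral_Ioc]

theorem christoffel_le {d n : ℕ} {x : E d} {D : Set (E d)} (p : MvPolynomial (Fin d) ℝ)
    (hp : p.totalDegree ≤ n) (hx : MvPolynomial.eval (fun i => x i) p = 1) :
    christoffel d n x D ≤ ∫ y in D, (MvPolynomial.eval (fun i => y i) p) ^ 2 := by
  refine csInf_le ⟨0, ?_⟩ ⟨p, hp, hx, rfl⟩
  rintro r ⟨q, -, -, rfl⟩
  exact integral_nonneg fun y => sq_nonneg _

/-- On the square, the Christoffel function is bounded by products of univariate integrals. -/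
theorem christoffel_squareS_le {n : ℕ} {z : E2} {P Q : Polynomial ℝ}
    (hdeg : P.natDegree + Q.natDegree ≤ n) (hP : P.eval (z 0) = 1) (hQ : Q.eval (z 1) = 1) :
    christoffel 2 n z squareS ≤
      (∫ x in (0:ℝ)..1, P.eval x ^ 2) * ∫ x in (0:ℝ)..1, Q.eval x ^ 2 := by
  have h := christoffel_le (n := n) (x := z) (D := squareS)
    (Polynomial.aeval (MvPolynomial.X 0) P * Polynomial.aeval (MvPolynomial.X 1) Q)
    ((MvPolynomial.totalDegree_mul _ _).trans
      ((add_le_add (totalDegree_aeval_X_le _ _) (totalDegree_aeval_X_le _ _)).trans hdeg))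
    (by simp only [map_mul, eval_aeval_X, hP, hQ, mul_one])
  simpa only [map_mul, eval_aeval_X, mul_pow,
    setIntegral_squareS_mul (fun x => P.eval x ^ 2) (fun x => Q.eval x ^ 2)] using h

/-- Upper bound for the Christoffel function on the unit square. -/
theorem stmt14 : ∃ c : ℝ, 0 < c ∧ ∀ n : ℕ, 1 ≤ n → ∀ z : E2,
    (128 * (n:ℝ)^2)⁻¹ ≤ z 0 → z 0 ≤ 1/2 → (128 * (n:ℝ)^2)⁻¹ ≤ z 1 → z 1 ≤ 1/2 →
    christoffel 2 n z squareS ≤ c * ((n:ℝ)^2)⁻¹ * Real.sqrt (z 0 * z 1) := by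
  refine ⟨(8208 * Real.pi) ^ 2, by positivity, fun n hn z h0 h0' h1 h1' => ?_⟩
  have hn0 : (0:ℝ) < n := by exact_mod_cast hn
  obtain ⟨M, hM⟩ : ∃ M, M = n / 2 + 1 := ⟨_, rfl⟩
  have hnM : (n:ℝ) ≤ 2 * M := by exact_mod_cast (by omega : n ≤ 2 * M)
  have hM1 : 1 ≤ M := by omega
  have key : ∀ t : ℝ, (128 * (n:ℝ)^2)⁻¹ ≤ t → 1 ≤ 512 * ((M:ℝ) ^ 2 * t) := by
    intro t ht
    have ht0 : 0 ≤ t := le_trans (by positivity) ht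
    calc (1:ℝ) ≤ 128 * (n:ℝ) ^ 2 * t := (inv_le_iff_one_le_mul₀' (by positivity)).1 ht
      _ ≤ 128 * (2 * (M:ℝ)) ^ 2 * t := by gcongr
      _ = _ := by ring
  have hbound : ∀ t : ℝ, 4104 * Real.pi * Real.sqrt t / M ≤
      8208 * Real.pi * Real.sqrt t / n := by
    intro t
    calc _ = 8208 * Real.pi * Real.sqrt t / (2 * M) := by field_simp; ring
      _ ≤ _ := by gcongr
  obtain ⟨P, hPd, hP, hPi⟩ := exists_polynomial_integral_sq_le hM1 (key _ h0) h0'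
  obtain ⟨Q, hQd, hQ, hQi⟩ := exists_polynomial_integral_sq_le hM1 (key _ h1) h1'
  refine (christoffel_squareS_le (by omega) hP hQ).trans ?_
  calc _ ≤ (8208 * Real.pi * Real.sqrt (z 0) / n) * (8208 * Real.pi * Real.sqrt (z 1) / n) := by
        refine mul_le_mul (hPi.trans (hbound _)) (hQi.trans (hbound _)) ?_ (by positivity)
        exact intervalIntegral.integral_nonneg zero_le_one fun x _ => sq_nonneg _
    _ = _ := by
        rw [Real.sqrt_mul (le_trans (by positivity) h0)]
        field_simp
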